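/- Let 𝒟 be a collection of random variables containing all constant functions, with coherent₁ marginal previsions P(·). Let 𝓛 be the linear span of all functions of the form X·1_B for X ∈ 𝒟 and B a nonempty event. Then there exists an extended-real-valued conditional prevision Q on the set {(X, B): X ∈ 𝓛, B a nonempty event} such that: the collection {Q(X|B): X ∈ 𝓛, B ≠ ∅} is coherent₁; Q(X|Ω) = P(X) for all X ∈ 𝒟; and for each nonempty event B, Q(·|B) is a finitely additive expectation on 𝓛 with Q(X·1_B|B) = Q(X|B) for all X ∈ 𝓛 (so Q is a finitely additive conditional expectation). -/

import Mathlib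

open scoped BigOperators

noncomputable section

/-- The indicator function of an event `B`, as a real-valued random variable. -/
def indicatorRV {Ω : Type*} (B : Set Ω) : Ω → ℝ := B.indicator fun _ => 1

/-- De Finetti-style coherence₁ for a collection of conditional previsions
`P (X i | B i)`, allowing infinite previsions.  For every finite subcollection,
all real coefficients `α j` (nonnegative where the prevision is `⊤`, nonpositive
where it is `⊥`), and all real prices `c j` that agree with the prevision wherever
it is finite, the resulting acceptable gamble has nonnegative supremum. -/
def Coherent1 {Ω I : Type*} (X : I → Ω → ℝ) (B : I → Set Ω) (P : I → EReal) : Prop :=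
  ∀ (n : ℕ) (idx : Fin n → I) (α c : Fin n → ℝ),
    (∀ j, P (idx j) = ⊤ → 0 ≤ α j) →
    (∀ j, P (idx j) = ⊥ → α j ≤ 0) →
    (∀ j, P (idx j) ≠ ⊤ → P (idx j) ≠ ⊥ → (c j : EReal) = P (idx j)) →
    0 ≤ ⨆ ω, ((∑ j, α j * indicatorRV (B (idx j)) ω * (X (idx j) ω - c j) : ℝ) : EReal)


/-- The linear span of all functions of the form `X·1_B` with `X ∈ D` and `B` a
nonempty event. -/
def condSpan {Ω : Type*} (D : Set (Ω → ℝ)) : Set (Ω → ℝ) :=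
  (Submodule.span ℝ {f : Ω → ℝ | ∃ X ∈ D, ∃ B : Set Ω, B.Nonempty ∧
    f = fun ω => X ω * indicatorRV B ω} : Submodule ℝ (Ω → ℝ))

/-- A salient pointed cone `C` and a vector `x` with `-x ∉ C` span a salient cone. -/
theorem PointedCone.salient_sup_hull_singleton {E : Type*} [AddCommGroup E] [Module ℝ E]
    {C : PointedCone ℝ E} (hC : ∀ x ∈ C, -x ∈ C → x = 0) {x : E} (hx : -x ∉ C) :
    ∀ y ∈ C ⊔ PointedCone.hull ℝ {x}, -y ∈ C ⊔ PointedCone.hull ℝ {x} → y = 0 := by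
  intro y hy hy'
  obtain ⟨k, hk, z, hz, rfl⟩ := Submodule.mem_sup.1 hy
  obtain ⟨k', hk', z', hz', h⟩ := Submodule.mem_sup.1 hy'
  obtain ⟨⟨t, ht⟩, rfl⟩ := Submodule.mem_span_singleton.1 hz
  obtain ⟨⟨t', ht'⟩, rfl⟩ := Submodule.mem_span_singleton.1 hz'
  simp only [Nonneg.mk_smul] at h ⊢
  have hsum : k + k' = (t + t') • -x := by
    rw [smul_neg, add_smul, eq_neg_iff_add_eq_zero,
      show k + k' + (t • x + t' • x) = (k' + t' • x) + (k + t • x) by abel, h, neg_add_cancel]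
  rcases (add_nonneg ht ht').eq_or_lt' with h0 | hpos
  · obtain rfl : t = 0 := by linarith
    obtain rfl : t' = 0 := by linarith
    have hk'' : k' = -k := by simpa using h
    simpa using hC k hk (hk'' ▸ hk')
  · refine absurd ?_ hx
    have := C.smul_mem (inv_nonneg.2 hpos.le) (C.add_mem hk hk')
    rwa [hsum, smul_smul, inv_mul_cancel₀ hpos.ne', one_smul] at this

/-- Every salient pointed cone extends to the nonnegative cone of a linear order. -/
theorem PointedCone.exists_total_salient_ge {E : Type*} [AddCommGroup E] [Module ℝ E]
    (K : PointedCone ℝ E) (hK : ∀ x ∈ K, -x ∈ K → x = 0) :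
    ∃ C : PointedCone ℝ E, K ≤ C ∧ (∀ x ∈ C, -x ∈ C → x = 0) ∧ ∀ x, x ∈ C ∨ -x ∈ C := by
  obtain ⟨C, hKC, hCs, hmax⟩ := zorn_le_nonempty₀
    {C : PointedCone ℝ E | ∀ x ∈ C, -x ∈ C → x = 0} (fun c hc hchain y hy ↦ by
      refine ⟨sSup c, fun x hx hx' ↦ ?_, fun z hz ↦ le_sSup hz⟩
      have hmem := fun z ↦ Submodule.mem_sSup_of_directed (z := z) ⟨y, hy⟩ hchain.directedOn
      obtain ⟨A, hA, hxA⟩ := (hmem _).1 hx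
      obtain ⟨B, hB, hxB⟩ := (hmem _).1 hx'
      rcases hchain.total hA hB with h | h
      · exact hc hB x (h hxA) hxB
      · exact hc hA x hxA (h hxB)) K hK
  refine ⟨C, hKC, hCs, fun x ↦ or_iff_not_imp_right.2 fun hx ↦ ?_⟩
  exact hmax (PointedCone.salient_sup_hull_singleton hCs hx) le_sup_left
    (Submodule.mem_sup_right (Submodule.subset_span rfl))

/-- The extended-real size of `x` measured in units of `u`, for the preorder whose nonnegative
cone is `C`. -/
def coneRatio {E : Type*} [AddCommGroup E] [Module ℝ E] (C : PointedCone ℝ E) (u x : E) : EReal :=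
  sSup ((fun c : ℝ ↦ (c : EReal)) '' {c | x - c • u ∈ C})

section coneRatio

variable {E : Type*} [AddCommGroup E] [Module ℝ E] {C : PointedCone ℝ E} {u x y : E}

theorem le_coneRatio {c : ℝ} (h : x - c • u ∈ C) : (c : EReal) ≤ coneRatio C u x :=
  le_sSup ⟨c, h, rfl⟩

theorem sub_smul_mem_of_lt_coneRatio (hu : u ∈ C) {c : ℝ} (h : (c : EReal) < coneRatio C u x) :
    x - c • u ∈ C := by
  obtain ⟨_, ⟨d, hd, rfl⟩, hcd⟩ := lt_sSup_iff.1 h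
  have hcd : c < d := EReal.coe_lt_coe_iff.1 hcd
  have := C.add_mem hd (C.smul_mem (sub_nonneg.2 hcd.le) hu)
  rwa [show x - d • u + (d - c) • u = x - c • u by module] at this

theorem smul_sub_mem_of_coneRatio_lt (ht : ∀ x, x ∈ C ∨ -x ∈ C) {c : ℝ}
    (h : coneRatio C u x < (c : EReal)) : c • u - x ∈ C := by
  rcases ht (x - c • u) with hc | hc
  · exact absurd (le_coneRatio hc) h.not_ge
  · rwa [neg_sub] at hc

theorem coneRatio_le (hs : ∀ x ∈ C, -x ∈ C → x = 0) (hu : u ∈ C) (hu0 : u ≠ 0) {c : ℝ}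
    (h : c • u - x ∈ C) : coneRatio C u x ≤ (c : EReal) := by
  refine sSup_le ?_
  rintro _ ⟨d, hd, rfl⟩
  refine EReal.coe_le_coe_iff.2 (le_of_not_gt fun hcd ↦ hu0 (hs u hu ?_))
  have := C.smul_mem (inv_nonneg.2 (sub_pos.2 hcd).le) (C.add_mem hd h)
  rwa [show x - d • u + (c • u - x) = (d - c) • -u by module, smul_smul,
    inv_mul_cancel₀ (sub_pos.2 hcd).ne', one_smul] at this

theorem coneRatio_mono (h : y - x ∈ C) : coneRatio C u x ≤ coneRatio C u y := by
  refine sSup_le ?_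
  rintro _ ⟨c, hc, rfl⟩
  refine le_coneRatio ?_
  simpa using C.add_mem h hc

theorem coneRatio_eq_coe (hs : ∀ x ∈ C, -x ∈ C → x = 0) (hu : u ∈ C) (hu0 : u ≠ 0) {r : ℝ}
    (h₁ : ∀ c < r, x - c • u ∈ C) (h₂ : ∀ c > r, c • u - x ∈ C) :
    coneRatio C u x = r := by
  refine le_antisymm (EReal.le_of_forall_lt_iff_le.1 fun z hz ↦ ?_)
    (EReal.ge_of_forall_gt_iff_ge.1 fun z hz ↦ ?_)
  · exact coneRatio_le hs hu hu0 (h₂ z (EReal.coe_lt_coe_iff.1 hz))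
  · exact le_coneRatio (h₁ z (EReal.coe_lt_coe_iff.1 hz))

theorem coneRatio_eq_top (h : ∀ c : ℝ, x - c • u ∈ C) : coneRatio C u x = ⊤ :=
  top_le_iff.1 (EReal.ge_of_forall_gt_iff_ge.1 fun z _ ↦ le_coneRatio (h z))

theorem coneRatio_eq_bot (hs : ∀ x ∈ C, -x ∈ C → x = 0) (hu : u ∈ C) (hu0 : u ≠ 0)
    (h : ∀ c : ℝ, c • u - x ∈ C) : coneRatio C u x = ⊥ :=
  le_bot_iff.1 (EReal.le_of_forall_lt_iff_le.1 fun z _ ↦ coneRatio_le hs hu hu0 (h z))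

theorem coneRatio_smul_self (hs : ∀ x ∈ C, -x ∈ C → x = 0) (hu : u ∈ C) (hu0 : u ≠ 0) (r : ℝ) :
    coneRatio C u (r • u) = r := by
  refine coneRatio_eq_coe hs hu hu0 (fun c hc ↦ ?_) fun c hc ↦ ?_ <;> rw [← sub_smul] <;>
    exact C.smul_mem (sub_nonneg.2 hc.le) hu

theorem coneRatio_neg (hs : ∀ x ∈ C, -x ∈ C → x = 0) (ht : ∀ x, x ∈ C ∨ -x ∈ C) (hu : u ∈ C)
    (hu0 : u ≠ 0) (x : E) : coneRatio C u (-x) = -coneRatio C u x := by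
  refine le_antisymm (EReal.le_of_forall_lt_iff_le.1 fun z hz ↦ ?_)
    (EReal.ge_of_forall_gt_iff_ge.1 fun z hz ↦ ?_)
  · refine coneRatio_le hs hu hu0 ?_
    have hz : ((-z : ℝ) : EReal) < coneRatio C u x := by
      rw [EReal.coe_neg]; exact EReal.neg_lt_comm.1 hz
    rw [show z • u - -x = x - (-z) • u by module]
    exact sub_smul_mem_of_lt_coneRatio hu hz
  · refine le_coneRatio ?_
    have hz : coneRatio C u x < ((-z : ℝ) : EReal) := by
      rw [EReal.coe_neg]; exact EReal.lt_neg_comm.1 hz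
    rw [show -x - z • u = (-z) • u - x by module]
    exact smul_sub_mem_of_coneRatio_lt ht hz

theorem mul_coneRatio_le (hu : u ∈ C) {a : ℝ} (ha : 0 < a) (x : E) :
    (a : EReal) * coneRatio C u x ≤ coneRatio C u (a • x) := by
  refine EReal.ge_of_forall_gt_iff_ge.1 fun z hz ↦ le_coneRatio ?_
  have hz : ((z / a : ℝ) : EReal) < coneRatio C u x := by
    rw [EReal.coe_div, EReal.div_lt_iff (EReal.coe_pos.2 ha) (EReal.coe_ne_top a), mul_comm]
    exact hz
  have := C.smul_mem ha.le (sub_smul_mem_of_lt_coneRatio hu hz)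
  rwa [smul_sub, smul_smul, mul_div_cancel₀ _ ha.ne'] at this

theorem coneRatio_smul_of_pos (hs : ∀ x ∈ C, -x ∈ C → x = 0) (ht : ∀ x, x ∈ C ∨ -x ∈ C)
    (hu : u ∈ C) (hu0 : u ≠ 0) {a : ℝ} (ha : 0 < a) (x : E) :
    coneRatio C u (a • x) = a * coneRatio C u x := by
  refine le_antisymm ?_ (mul_coneRatio_le hu ha x)
  rw [← EReal.neg_le_neg_iff, ← mul_neg, ← coneRatio_neg hs ht hu hu0,
    ← coneRatio_neg hs ht hu hu0, ← smul_neg]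
  exact mul_coneRatio_le hu ha (-x)

theorem coneRatio_smul (hs : ∀ x ∈ C, -x ∈ C → x = 0) (ht : ∀ x, x ∈ C ∨ -x ∈ C)
    (hu : u ∈ C) (hu0 : u ≠ 0) (a : ℝ) (x : E) :
    coneRatio C u (a • x) = a * coneRatio C u x := by
  rcases lt_trichotomy a 0 with ha | rfl | ha
  · rw [← neg_neg a, neg_smul, coneRatio_neg hs ht hu hu0,
      coneRatio_smul_of_pos hs ht hu hu0 (neg_pos.2 ha), EReal.coe_neg (-a), neg_mul]
  · simpa using coneRatio_smul_self hs hu hu0 0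
  · exact coneRatio_smul_of_pos hs ht hu hu0 ha x

theorem coneRatio_add (hs : ∀ x ∈ C, -x ∈ C → x = 0) (ht : ∀ x, x ∈ C ∨ -x ∈ C) (hu : u ∈ C)
    (hu0 : u ≠ 0) (h₁ : coneRatio C u x ≠ ⊥ ∨ coneRatio C u y ≠ ⊤)
    (h₂ : coneRatio C u x ≠ ⊤ ∨ coneRatio C u y ≠ ⊥) :
    coneRatio C u (x + y) = coneRatio C u x + coneRatio C u y := by
  refine le_antisymm (EReal.le_add_of_forall_gt h₁ h₂ fun a ha b hb ↦ ?_)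
    (EReal.add_le_of_forall_lt fun a ha b hb ↦ ?_)
  · obtain ⟨r, hr, hra⟩ := EReal.lt_iff_exists_real_btwn.1 ha
    obtain ⟨s, hs', hsb⟩ := EReal.lt_iff_exists_real_btwn.1 hb
    refine le_trans ?_ (add_le_add hra.le hsb.le)
    rw [← EReal.coe_add]
    refine coneRatio_le hs hu hu0 ?_
    have := C.add_mem (smul_sub_mem_of_coneRatio_lt ht hr) (smul_sub_mem_of_coneRatio_lt ht hs')
    rwa [show r • u - x + (s • u - y) = (r + s) • u - (x + y) by module] at this
  · obtain ⟨r, har, hr⟩ := EReal.lt_iff_exists_real_btwn.1 ha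
    obtain ⟨s, hbs, hs'⟩ := EReal.lt_iff_exists_real_btwn.1 hb
    refine (add_le_add har.le hbs.le).trans ?_
    rw [← EReal.coe_add]
    refine le_coneRatio ?_
    have := C.add_mem (sub_smul_mem_of_lt_coneRatio hu hr) (sub_smul_mem_of_lt_coneRatio hu hs')
    rwa [show x - r • u + (y - s • u) = (x + y) - (r + s) • u by module] at this

/-- A bet on `x` that is fair or favourable at the price `coneRatio C u x` becomes nonnegative
after adding any positive multiple of the unit `u`. -/
theorem smul_sub_add_mem_of_coneRatio (ht : ∀ x, x ∈ C ∨ -x ∈ C) (hu : u ∈ C) {α c ε : ℝ}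
    (hε : 0 < ε) (htop : coneRatio C u x = ⊤ → 0 ≤ α) (hbot : coneRatio C u x = ⊥ → α ≤ 0)
    (hfin : coneRatio C u x ≠ ⊤ → coneRatio C u x ≠ ⊥ → (c : EReal) = coneRatio C u x) :
    α • (x - c • u) + ε • u ∈ C := by
  rcases lt_trichotomy α 0 with hα | rfl | hα
  · have hlt : coneRatio C u x < ((c + ε / -α : ℝ) : EReal) := by
      by_cases hb : coneRatio C u x = ⊥
      · rw [hb]; exact EReal.bot_lt_coe _
      · rw [← hfin (fun h ↦ (htop h).not_gt hα) hb, EReal.coe_lt_coe_iff]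
        have := div_pos hε (neg_pos.2 hα)
        linarith
    have := C.smul_mem (neg_pos.2 hα).le (smul_sub_mem_of_coneRatio_lt ht hlt)
    rwa [smul_sub, smul_smul, mul_add, mul_div_cancel₀ _ (neg_pos.2 hα).ne',
      show (-α * c + ε) • u - -α • x = α • (x - c • u) + ε • u by module] at this
  · simpa using C.smul_mem hε.le hu
  · have hlt : ((c - ε / α : ℝ) : EReal) < coneRatio C u x := by
      by_cases hb : coneRatio C u x = ⊤
      · rw [hb]; exact EReal.coe_lt_top _
      · rw [← hfin hb (fun h ↦ (hbot h).not_gt hα), EReal.coe_lt_coe_iff]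
        have := div_pos hε hα
        linarith
    have := C.smul_mem hα.le (sub_smul_mem_of_lt_coneRatio hu hlt)
    rwa [smul_sub, smul_smul, mul_sub, mul_div_cancel₀ _ hα.ne',
      show α • x - (α * c - ε) • u = α • (x - c • u) + ε • u by module] at this

end coneRatio

theorem indicatorRV_univ {Ω : Type*} : indicatorRV (Set.univ : Set Ω) = 1 := by
  ext; simp [indicatorRV]

theorem indicatorRV_nonneg {Ω : Type*} (B : Set Ω) : 0 ≤ indicatorRV B :=
  fun ω ↦ Set.indicator_nonneg (fun _ _ ↦ zero_le_one) ω

theorem indicatorRV_le_one {Ω : Type*} (B : Set Ω) : indicatorRV B ≤ 1 :=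
  fun ω ↦ Set.indicator_le' (fun _ _ ↦ le_rfl) (fun _ _ ↦ zero_le_one) ω

theorem indicatorRV_ne_zero {Ω : Type*} {B : Set Ω} (hB : B.Nonempty) : indicatorRV B ≠ 0 := by
  obtain ⟨ω, hω⟩ := hB
  intro h
  simpa [indicatorRV, hω] using congrFun h ω

theorem indicatorRV_mul_self {Ω : Type*} (B : Set Ω) :
    indicatorRV B * indicatorRV B = indicatorRV B := by
  ext ω
  by_cases h : ω ∈ B <;> simp [indicatorRV, h]

/-- The prevision obtained by comparing `X * 1_B` with `1_B` in a linear vector order extending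
the pointwise order is coherent. -/
theorem coherent1_coneRatio {Ω I : Type*} [Nonempty Ω] {C : PointedCone ℝ (Ω → ℝ)}
    (hs : ∀ x ∈ C, -x ∈ C → x = 0) (ht : ∀ x, x ∈ C ∨ -x ∈ C) (hpos : ∀ g, 0 ≤ g → g ∈ C)
    (X : I → Ω → ℝ) (B : I → Set Ω) :
    Coherent1 X B fun i ↦ coneRatio C (indicatorRV (B i)) (X i * indicatorRV (B i)) := by
  intro n idx α c htop hbot hfin
  by_contra! hlt
  obtain ⟨r, hr, hr0⟩ := EReal.lt_iff_exists_real_btwn.1 hlt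
  have hr0 : r < 0 := by exact_mod_cast hr0
  set S : Ω → ℝ := fun ω ↦ ∑ j, α j * indicatorRV (B (idx j)) ω * (X (idx j) ω - c j) with hS
  have hSr : ∀ ω, S ω < r := fun ω ↦ by
    exact_mod_cast (le_iSup (fun ω ↦ ((S ω : ℝ) : EReal)) ω).trans_lt hr
  set ε : ℝ := -r / (n + 1) with hε
  have hn : (0 : ℝ) < n + 1 := by positivity
  have hε0 : 0 < ε := div_pos (neg_pos.2 hr0) hn
  have hεr : (n : ℝ) * ε < -r := by
    have : (n + 1) * ε = -r := mul_div_cancel₀ _ hn.ne'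
    linarith
  have hmem : S + ((n : ℝ) * ε) • (1 : Ω → ℝ) ∈ C := by
    have hj : ∀ j ∈ Finset.univ, α j • (X (idx j) * indicatorRV (B (idx j))
        - c j • indicatorRV (B (idx j))) + ε • (1 : Ω → ℝ) ∈ C := fun j _ ↦ by
      have h₁ := smul_sub_add_mem_of_coneRatio ht (hpos _ (indicatorRV_nonneg _)) hε0 (htop j)
        (hbot j) (hfin j)
      have h₂ := C.smul_mem hε0.le
        (hpos _ (sub_nonneg.2 (indicatorRV_le_one (B (idx j)))))
      have := C.add_mem h₁ h₂
      rwa [add_assoc, ← smul_add, add_sub_cancel] at this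
    convert C.sum_mem hj using 1
    ext ω
    simp only [hS, Pi.add_apply, Finset.sum_apply, Pi.smul_apply, Pi.sub_apply, Pi.mul_apply,
      smul_eq_mul, Pi.one_apply, Finset.sum_add_distrib, Finset.sum_const, Finset.card_univ,
      Fintype.card_fin, nsmul_eq_mul, mul_one]
    congr 1
    exact Finset.sum_congr rfl fun j _ ↦ by ring
  have hneg : ∀ ω, (S + ((n : ℝ) * ε) • (1 : Ω → ℝ)) ω < 0 := fun ω ↦ by
    simpa using (by linarith [hSr ω] : S ω + n * ε < 0)
  have hzero := hs _ hmem (hpos _ fun ω ↦ (neg_pos.2 (hneg ω)).le)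
  obtain ⟨ω⟩ := ‹Nonempty Ω›
  exact (hneg ω).ne (congrFun hzero ω)

/-- The single bets `α (X - c)` with `X ∈ D` that a bettor with marginal previsions `P` accepts. -/
def marginalBets {Ω : Type*} (D : Set (Ω → ℝ)) (P : (Ω → ℝ) → EReal) : Set (Ω → ℝ) :=
  {g | ∃ X ∈ D, ∃ α c : ℝ, (P X = ⊤ → 0 ≤ α) ∧ (P X = ⊥ → α ≤ 0) ∧
    (P X ≠ ⊤ → P X ≠ ⊥ → (c : EReal) = P X) ∧ g = fun ω ↦ α * (X ω - c)}

theorem Coherent1.not_le_of_mem_hull_marginalBets {Ω : Type*} {D : Set (Ω → ℝ)}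
    {P : (Ω → ℝ) → EReal}
    (hcoh : Coherent1 (fun f : D ↦ (f : Ω → ℝ)) (fun _ ↦ (Set.univ : Set Ω)) (fun f ↦ P f))
    {h : Ω → ℝ} (hh : h ∈ PointedCone.hull ℝ (marginalBets D P)) {r : ℝ} (hr : r < 0) :
    ¬ ∀ ω, h ω ≤ r := by
  intro hle
  obtain ⟨n, t, g, rfl⟩ := Submodule.mem_span_set'.1 hh
  choose X hX α c htop hbot hfin hg using fun j ↦ (g j).2
  have := hcoh n (fun j ↦ ⟨X j, hX j⟩) (fun j ↦ (t j : ℝ) * α j) c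
    (fun j hj ↦ mul_nonneg (t j).2 (htop j hj))
    (fun j hj ↦ mul_nonpos_of_nonneg_of_nonpos (t j).2 (hbot j hj)) hfin
  refine absurd (this.trans (iSup_le (a := (r : EReal)) fun ω ↦ ?_)) (not_le.2 ?_)
  · refine EReal.coe_le_coe_iff.2 (le_of_eq_of_le ?_ (hle ω))
    rw [Finset.sum_apply]
    refine Finset.sum_congr rfl fun j _ ↦ ?_
    rw [Pi.smul_apply, hg j, indicatorRV_univ]
    simp [mul_assoc]
    rfl
  · exact_mod_cast hr

/-- The cone of gambles that are nonnegative or uniformly better than some member of `G`. -/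
def desirableCone {Ω : Type*} (G : PointedCone ℝ (Ω → ℝ)) : PointedCone ℝ (Ω → ℝ) where
  carrier := {g | 0 ≤ g ∨ ∃ h ∈ G, ∃ ε > 0, ∀ ω, h ω + ε ≤ g ω}
  zero_mem' := Or.inl le_rfl
  add_mem' := by
    rintro g g' (hg | ⟨h, hh, ε, hε, hg⟩) (hg' | ⟨h', hh', ε', hε', hg'⟩)
    · exact Or.inl (add_nonneg hg hg')
    · exact Or.inr ⟨h', hh', ε', hε', fun ω ↦ by
        have h0 : 0 ≤ g ω := hg ω
        simpa using (by linarith [hg' ω] : h' ω + ε' ≤ g ω + g' ω)⟩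
    · exact Or.inr ⟨h, hh, ε, hε, fun ω ↦ by
        have h0 : 0 ≤ g' ω := hg' ω
        simpa using (by linarith [hg ω] : h ω + ε ≤ g ω + g' ω)⟩
    · exact Or.inr ⟨h + h', G.add_mem hh hh', ε + ε', add_pos hε hε', fun ω ↦ by
        simpa using (by linarith [hg ω, hg' ω] : h ω + h' ω + (ε + ε') ≤ g ω + g' ω)⟩
  smul_mem' := by
    rintro ⟨a, ha⟩ g (hg | ⟨h, hh, ε, hε, hg⟩)
    · exact Or.inl (smul_nonneg ha hg)
    · rcases ha.eq_or_lt' with rfl | ha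
      · exact Or.inl (by simp [Nonneg.mk_smul])
      · exact Or.inr ⟨a • h, G.smul_mem ha.le hh, a * ε, mul_pos ha hε, fun ω ↦ by
          simpa [Nonneg.mk_smul, mul_add] using mul_le_mul_of_nonneg_left (hg ω) ha.le⟩

theorem salient_desirableCone {Ω : Type*} {G : PointedCone ℝ (Ω → ℝ)}
    (hG : ∀ h ∈ G, ∀ r < (0 : ℝ), ¬ ∀ ω, h ω ≤ r) :
    ∀ g ∈ desirableCone G, -g ∈ desirableCone G → g = 0 := by
  rintro g (hg | ⟨h, hh, ε, hε, hg⟩) (hg' | ⟨h', hh', ε', hε', hg'⟩)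
  · exact le_antisymm (neg_nonneg.1 hg') hg
  · refine absurd (fun ω ↦ ?_) (hG h' hh' (-ε') (neg_lt_zero.2 hε'))
    have h₁ : 0 ≤ g ω := hg ω
    have h₂ : h' ω + ε' ≤ -g ω := hg' ω
    linarith
  · refine absurd (fun ω ↦ ?_) (hG h hh (-ε) (neg_lt_zero.2 hε))
    have h₁ : 0 ≤ -g ω := hg' ω
    linarith [hg ω]
  · refine absurd (fun ω ↦ ?_) (hG _ (G.add_mem hh hh') (-(ε + ε')) (by linarith))
    have h₂ : h' ω + ε' ≤ -g ω := hg' ω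
    rw [Pi.add_apply]
    linarith [hg ω]

theorem coneRatio_eq_of_marginalBets {Ω : Type*} [Nonempty Ω] {D : Set (Ω → ℝ)}
    {P : (Ω → ℝ) → EReal} {C : PointedCone ℝ (Ω → ℝ)}
    (hC : desirableCone (PointedCone.hull ℝ (marginalBets D P)) ≤ C)
    (hs : ∀ x ∈ C, -x ∈ C → x = 0) {X : Ω → ℝ} (hX : X ∈ D) : coneRatio C 1 X = P X := by
  have hu : (1 : Ω → ℝ) ∈ C := hC (Or.inl zero_le_one)
  have hbet {α c ε : ℝ} {g : Ω → ℝ} (htop : P X = ⊤ → 0 ≤ α) (hbot : P X = ⊥ → α ≤ 0)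
      (hfin : P X ≠ ⊤ → P X ≠ ⊥ → (c : EReal) = P X) (hε : 0 < ε)
      (hg : ∀ ω, α * (X ω - c) + ε = g ω) : g ∈ C :=
    hC (Or.inr ⟨_, Submodule.subset_span ⟨X, hX, α, c, htop, hbot, hfin, rfl⟩, ε, hε,
      fun ω ↦ (hg ω).le⟩)
  induction hP : P X with
  | bot =>
    exact coneRatio_eq_bot hs hu one_ne_zero fun c ↦
      hbet (α := -1) (c := c - 1) (ε := 1) (by simp [hP]) (by simp) (by simp [hP]) one_pos
        fun ω ↦ by simp; ring
  | coe r =>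
    refine coneRatio_eq_coe hs hu one_ne_zero (fun c hc ↦ ?_) fun c hc ↦ ?_
    · exact hbet (α := 1) (c := r) (by simp) (by simp [hP]) (by simp [hP]) (sub_pos.2 hc)
        fun ω ↦ by simp
    · exact hbet (α := -1) (c := r) (by simp [hP]) (by simp) (by simp [hP]) (sub_pos.2 hc)
        fun ω ↦ by simp
  | top =>
    exact coneRatio_eq_top fun c ↦
      hbet (α := 1) (c := c + 1) (ε := 1) (by simp) (by simp [hP]) (by simp [hP]) one_pos
        fun ω ↦ by simp; ring

/-- Let `D` be a collection of random variables containing all constants with a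
coherent₁ marginal prevision `P`, and let `condSpan D` be the linear span of all
functions `X·1_B` with `X ∈ D` and `B` nonempty.  Then there is a conditional
prevision `Q` on `{(X, B) : X ∈ condSpan D, B ≠ ∅}` which is coherent₁, agrees with
`P` on `D` (given `Ω`), and is such that for each nonempty event `B`, `Q (·|B)` is a
finitely additive expectation on `condSpan D` (normalized, monotone, extended-linear
where well defined) satisfying `Q (X·1_B|B) = Q (X|B)`; that is, `Q` is a finitely
additive conditional expectation. -/
theorem exists_fa_conditional_expectation {Ω : Type*} [Nonempty Ω]
    (D : Set (Ω → ℝ)) (hconst : ∀ c : ℝ, (fun _ => c) ∈ D)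
    (P : (Ω → ℝ) → EReal)
    (hcoh : Coherent1 (fun f : D => (f : Ω → ℝ)) (fun _ => (Set.univ : Set Ω))
      (fun f => P f)) :
    ∃ Q : (Ω → ℝ) → Set Ω → EReal,
      Coherent1
        (fun i : {p : (Ω → ℝ) × Set Ω // p.1 ∈ condSpan D ∧ p.2.Nonempty} => i.1.1)
        (fun i => i.1.2) (fun i => Q i.1.1 i.1.2) ∧
      (∀ X ∈ D, Q X Set.univ = P X) ∧
      (∀ B : Set Ω, B.Nonempty →
        Q (fun _ => 1) B = 1 ∧
        (∀ X ∈ condSpan D, ∀ Y ∈ condSpan D, (∀ ω, X ω ≤ Y ω) → Q X B ≤ Q Y B) ∧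
        (∀ (a b : ℝ), ∀ X ∈ condSpan D, ∀ Y ∈ condSpan D,
          ¬(((a : EReal) * Q X B = ⊤ ∧ (b : EReal) * Q Y B = ⊥) ∨
            ((a : EReal) * Q X B = ⊥ ∧ (b : EReal) * Q Y B = ⊤)) →
          Q (fun ω => a * X ω + b * Y ω) B = (a : EReal) * Q X B + (b : EReal) * Q Y B) ∧
        (∀ X ∈ condSpan D, Q (fun ω => X ω * indicatorRV B ω) B = Q X B)) := by
  obtain ⟨C, hKC, hs, ht⟩ := PointedCone.exists_total_salient_ge _ (salient_desirableCone
    fun h hh r hr ↦ Coherent1.not_le_of_mem_hull_marginalBets hcoh hh hr)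
  have hpos : ∀ g : Ω → ℝ, 0 ≤ g → g ∈ C := fun g hg ↦ hKC (Or.inl hg)
  refine ⟨fun X B ↦ coneRatio C (indicatorRV B) (X * indicatorRV B),
    coherent1_coneRatio hs ht hpos _ _, fun X hX ↦ ?_, fun B hB ↦ ?_⟩
  · simpa [indicatorRV_univ] using coneRatio_eq_of_marginalBets hKC hs hX
  · have hu := hpos _ (indicatorRV_nonneg B)
    have hu0 := indicatorRV_ne_zero hB
    refine ⟨?_, fun X _ Y _ hXY ↦ coneRatio_mono (hpos _ ?_), fun a b X _ Y _ h ↦ ?_,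
      fun X _ ↦ ?_⟩
    · have := coneRatio_smul_self hs hu hu0 1
      rw [one_smul, EReal.coe_one] at this
      exact (congrArg _ (one_mul _)).trans this
    · rw [← sub_mul]
      exact mul_nonneg (sub_nonneg.2 hXY) (indicatorRV_nonneg B)
    · beta_reduce
      rw [show (fun ω ↦ a * X ω + b * Y ω) * indicatorRV B
        = a • (X * indicatorRV B) + b • (Y * indicatorRV B) by
          ext ω; simp only [Pi.mul_apply, Pi.add_apply, Pi.smul_apply, smul_eq_mul]; ring]
      simp only [← coneRatio_smul hs ht hu hu0] at h ⊢
      exact coneRatio_add hs ht hu hu0 (by tauto) (by tauto)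
    · change coneRatio C _ (X * indicatorRV B * indicatorRV B) = _
      rw [mul_assoc, indicatorRV_mul_self]

end
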